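/- Let C = (1̂ = P_0 ⋗ P_1 ⋗ ⋯ ⋗ P_l) be a saturated chain in the Tamari lattice T_n in terms of Dyck paths of length 2n, beginning at the maximum element 1̂. Fix k ∈ [n], and for each 0 ≤ j ≤ l let h_j be the height of the prime Dyck subpath of P_j beginning with its k-th north step. Then h_0 ≥ h_1 ≥ ⋯ ≥ h_l. -/

import Mathlib

/-!
Common definitions for formalizing "A recursion on maximal chains in the Tamari lattices"
(L. Nelson).

* Young diagrams are encoded by their row-length functions `lam : ℕ → ℕ` (rows indexed from 1,
  with `lam 0 = 0`).
* Dyck paths are lists of steps (north/east).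
* Tableaux are encoded by entry functions `f : ℕ × ℕ → ℕ` (1-indexed boxes; value `0` means
  "no box").  The label of box `(x, y)` is `f (x, y)`.
-/

noncomputable section

namespace TamariMaxChains

/-- A step of a lattice path: north or east. -/
inductive Step : Type
  | N : Step
  | E : Step
deriving DecidableEq

/-- Number of north steps of a path. -/
def nCount (p : List Step) : ℕ := p.count Step.N

/-- Number of east steps of a path. -/
def eCount (p : List Step) : ℕ := p.count Step.E

/-- `p` is a Dyck path: equally many norths and easts, and every prefix has at least as many
north steps as east steps (the path never goes below the diagonal `y = x`). -/
def IsDyck (p : List Step) : Prop :=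
  nCount p = eCount p ∧ ∀ q : List Step, q <+: p → eCount q ≤ nCount q

/-- `q` is a prime Dyck path: it meets the slope-one line joining its endpoints only at its
endpoints. -/
def IsPrimeDyck (q : List Step) : Prop :=
  q ≠ [] ∧ nCount q = eCount q ∧
    ∀ s : List Step, s <+: q → s ≠ [] → s ≠ q → eCount s < nCount s

/-- Covering relation of the Tamari lattice on Dyck paths:  `TamariCoverD P' P` means `P'`
covers `P`, i.e. `P'` is obtained from `P` by swapping an east step that is followed by a north
step with the prime Dyck subpath following it. -/
def TamariCoverD (P' P : List Step) : Prop :=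
  ∃ a q b : List Step, IsPrimeDyck q ∧
    P = a ++ Step.E :: (q ++ b) ∧ P' = a ++ (q ++ Step.E :: b)

/-- `lam` is the row-length function of a Young diagram: rows are indexed from `1`,
`lam x` is the number of boxes in row `x`, rows weakly decrease, finitely many boxes. -/
def IsDiagram (lam : ℕ → ℕ) : Prop :=
  lam 0 = 0 ∧ (∀ x, 1 ≤ x → lam (x + 1) ≤ lam x) ∧ ∃ N, ∀ x, N ≤ x → lam x = 0

/-- The height (number of north steps) of the prime path of row `d ≥ 1` of the Young diagram
with row lengths `lam`:  the least `t ≥ 1` such that either `t = d` (row `0` being regarded as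
an infinite row of boxes) or row `d - t` has length at least `lam d + t`. -/
def primeHeight (lam : ℕ → ℕ) (d : ℕ) : ℕ :=
  sInf {t | 1 ≤ t ∧ (t = d ∨ (t < d ∧ lam d + t ≤ lam (d - t)))}

/-- The last box of row `d` is a corner box (last box of its row and lowest box of
its column). -/
def IsCorner (lam : ℕ → ℕ) (d : ℕ) : Prop := 1 ≤ d ∧ 1 ≤ lam d ∧ lam (d + 1) < lam d

/-- The result of removing the `B`-strip of the last box `B` of row `d`: the last box of each of
the rows `d - h + 1, …, d` is removed, where `h` is the height of the prime path of row `d`. -/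
def removeStrip (lam : ℕ → ℕ) (d : ℕ) : ℕ → ℕ := fun x =>
  if d + 1 ≤ x + primeHeight lam d ∧ x ≤ d then lam x - 1 else lam x

/-- Covering relation of the Tamari lattice on Young diagrams:  `mu` covers `lam` iff `mu` is
obtained from `lam` by removing the `B`-strip of a corner box `B`. -/
def TamariCoverY (mu lam : ℕ → ℕ) : Prop := ∃ d, IsCorner lam d ∧ mu = removeStrip lam d

/-- The `B`-strip of the last box `B` of row `d`: the set of last boxes of rows
`d - h + 1, …, d`, where `h` is the height of the prime path of row `d`. -/
def stripSet (lam : ℕ → ℕ) (d : ℕ) : Set (ℕ × ℕ) :=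
  {b | b.2 = lam b.1 ∧ 1 ≤ b.2 ∧ d + 1 ≤ b.1 + primeHeight lam d ∧ b.1 ≤ d}

/-- The enclosure of the `B`-strip of the last box `B = (d, lam d)` of row `d`: all boxes
`(x, y)` with `d - h ≤ x ≤ d` and `lam d ≤ y ≤ lam d + h`, where row `0` is regarded as an
infinite row of boxes. -/
def enclosure (lam : ℕ → ℕ) (d : ℕ) : Set (ℕ × ℕ) :=
  {b | (b.1 = 0 ∨ b.2 ≤ lam b.1) ∧ 1 ≤ b.2 ∧
    d ≤ b.1 + primeHeight lam d ∧ b.1 ≤ d ∧ lam d ≤ b.2 ∧ b.2 ≤ lam d + primeHeight lam d}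

/-- The Dyck path of length `2 n` corresponding to the Young diagram `lam` contained in the
staircase `δ_{n-1}` (the Dyck path is the silhouette of the Young diagram). -/
def toDyck (n : ℕ) (lam : ℕ → ℕ) : List Step :=
  ((List.range n).flatMap fun k =>
    List.replicate (lam (n - k) - lam (n - k + 1)) Step.E ++ [Step.N]) ++
    List.replicate (n - lam 1) Step.E

/-- The prime path of row `d` of the Young diagram `lam`, as its list of steps (read from its
lower-left endpoint). -/
def primePathList (lam : ℕ → ℕ) (d : ℕ) : List Step :=
  Step.N :: ((((List.range (primeHeight lam d - 1)).flatMap fun j =>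
    List.replicate (lam (d - 1 - j) - lam (d - j)) Step.E ++ [Step.N])) ++
    List.replicate (lam d + primeHeight lam d - lam (d - (primeHeight lam d - 1))) Step.E)

/-- `S` translates to `S'` by `p` units down and `q` units to the right. -/
def TranslatesBy (p q : ℤ) (S S' : Set (ℕ × ℕ)) : Prop :=
  ∀ x y : ℕ, (x, y) ∈ S' ↔ ∃ a b : ℕ, (a, b) ∈ S ∧ (x : ℤ) = a + p ∧ (y : ℤ) = b + q

/-- `S` translates to `S'`. -/
def Translates (S S' : Set (ℕ × ℕ)) : Prop := ∃ p q : ℤ, TranslatesBy p q S S'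

/-- The length of a tableau: its number of distinct labels (for an honest tableau, labels are
exactly `1, …, tlen f`). -/
def tlen (f : ℕ × ℕ → ℕ) : ℕ := sSup {v | v ≠ 0 ∧ ∃ b, f b = v}

/-- The number of boxes in row `x` of a tableau. -/
def rowLen (f : ℕ × ℕ → ℕ) (x : ℕ) : ℕ := sSup {y | f (x, y) ≠ 0}

/-- The number of boxes in column `y` of a tableau. -/
def colLen (f : ℕ × ℕ → ℕ) (y : ℕ) : ℕ := sSup {x | f (x, y) ≠ 0}

/-- `f` is (the entry function of) a tableau: the support is a Young diagram (1-indexed),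
rows strictly increase, columns weakly increase, and the set of labels is exactly
`{1, …, tlen f}`. -/
def IsTableau (f : ℕ × ℕ → ℕ) : Prop :=
  (∀ y, f (0, y) = 0) ∧ (∀ x, f (x, 0) = 0) ∧
  {b : ℕ × ℕ | f b ≠ 0}.Finite ∧
  (∀ x y x' y', 1 ≤ x' → x' ≤ x → 1 ≤ y' → y' ≤ y → f (x, y) ≠ 0 → f (x', y') ≠ 0) ∧
  (∀ x y, f (x, y) ≠ 0 → f (x, y + 1) ≠ 0 → f (x, y) < f (x, y + 1)) ∧
  (∀ x y, f (x, y) ≠ 0 → f (x + 1, y) ≠ 0 → f (x, y) ≤ f (x + 1, y)) ∧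
  (∀ v, 1 ≤ v → (v ≤ tlen f ↔ ∃ b, f b = v))

/-- `T^(r)`: the subtableau of all entries at most `r`. -/
def trunc (f : ℕ × ℕ → ℕ) (r : ℕ) : ℕ × ℕ → ℕ := fun b => if f b ≤ r then f b else 0

/-- The shape (row-length function) of a tableau. -/
def shapeOf (f : ℕ × ℕ → ℕ) : ℕ → ℕ := fun x => rowLen f x

/-- The row index of the end-box of the `k`-set of `f` (the maximal row index of a box
labeled `k`). -/
def endRow (f : ℕ × ℕ → ℕ) (k : ℕ) : ℕ := sSup {x | ∃ y, f (x, y) = k}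

/-- `Y 0 ⋗ Y 1 ⋗ ⋯ ⋗ Y l` is a saturated chain in the Tamari order on Young diagrams whose
maximal element `Y 0` is the empty diagram (each `Y r` covers `Y (r+1)`). -/
def IsTamariChain (Y : ℕ → ℕ → ℕ) (l : ℕ) : Prop :=
  (∀ r, r ≤ l → IsDiagram (Y r)) ∧ (∀ x, Y 0 x = 0) ∧
    ∀ r, r < l → TamariCoverY (Y r) (Y (r + 1))

/-- The tableau `ψ(C)` of the saturated chain `C = (∅ = Y 0 ⋗ ⋯ ⋗ Y l)`: the boxes removed in
the transition `Y (r-1) ⋗ Y r` are labeled `r`; that is, each box of `Y l` is labeled by the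
least `r` such that the box belongs to `Y r`. -/
def psiFun (Y : ℕ → ℕ → ℕ) (l : ℕ) : ℕ × ℕ → ℕ := fun b =>
  if 1 ≤ b.1 ∧ 1 ≤ b.2 ∧ b.2 ≤ Y l b.1 then sInf {r | r ≤ l ∧ b.2 ≤ Y r b.1} else 0

/-- `f` is a `ψ`-tableau: it is in the image of `ψ`. -/
def IsPsiTab (f : ℕ × ℕ → ℕ) : Prop :=
  ∃ l Y, IsTamariChain Y l ∧ f = psiFun Y l

/-- Row lengths of the staircase shape `δ_{n-1} = (n-1, n-2, …, 1)`: row `x ≥ 1` has `n - x`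
boxes. -/
def dstair (n : ℕ) : ℕ → ℕ := fun x => if x = 0 then 0 else n - x

/-- `C_i(n)`, via `ψ`: the set of maximal chains of length `n + i` in the Tamari lattice `T_n`,
identified with the `ψ`-tableaux of length `n + i` and shape `δ_{n-1}`. -/
def MemC (i : ℤ) (n : ℕ) (f : ℕ × ℕ → ℕ) : Prop :=
  IsTableau f ∧ IsPsiTab f ∧ (∀ x, rowLen f x = dstair n x) ∧ (tlen f : ℤ) = (n : ℤ) + i

/-- The `r`-set of `f` (of shape `δ_{n-1}`) is a full-set with end-box `(k, n - k)`:
it begins in row `1` and ends in the outer diagonal, at the box `(k, n - k)`. -/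
def HasFullSetAt (f : ℕ × ℕ → ℕ) (n r k : ℕ) : Prop :=
  (∃ y, f (1, y) = r) ∧ 1 ≤ k ∧ k ≤ n - 1 ∧ f (k, n - k) = r ∧
    ∀ x y, f (x, y) = r → x ≤ k

/-- `f` has an `r`-full-set. -/
def HasFullSet (f : ℕ × ℕ → ℕ) (n r : ℕ) : Prop := ∃ k, HasFullSetAt f n r k

/-- `f` has an `r⁺`-full-set (plus-full-set): an `r`-full-set whose end-box `(k, n-k)` satisfies
`k = n - 1`, or `k ≤ n - 2` and the southwest neighbor has a smaller label. -/
def HasPlusFullSet (f : ℕ × ℕ → ℕ) (n r : ℕ) : Prop :=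
  ∃ k, HasFullSetAt f n r k ∧ (k = n - 1 ∨ (k ≤ n - 2 ∧ f (k + 1, n - k - 1) < r))

/-- `F_i^r(n)`: the set of `C ∈ C_i(n)` whose `r`-set is a plus-full-set and whose `j`-set is
not a plus-full-set for any `j ∈ [r-1]`. -/
def MemF (i : ℤ) (n : ℕ) (r : ℕ) (f : ℕ × ℕ → ℕ) : Prop :=
  MemC i n f ∧ HasPlusFullSet f n r ∧ ∀ j, 1 ≤ j → j < r → ¬ HasPlusFullSet f n j

/-- `N_i(n)`: the set of `C ∈ C_i(n)` having no plus-full-sets. -/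
def MemN (i : ℤ) (n : ℕ) (f : ℕ × ℕ → ℕ) : Prop :=
  MemC i n f ∧ ∀ r, ¬ HasPlusFullSet f n r

/-- `α_d`: shift all rows of index greater than `d` down one row and repeat row `d` in
row `d + 1`. -/
def alphaFun (d : ℕ) (f : ℕ × ℕ → ℕ) : ℕ × ℕ → ℕ := fun b =>
  if b.1 ≤ d then f b else f (b.1 - 1, b.2)

/-- `β_d`: append a box labeled `tlen f + 1` at the end of each of the rows `1, …, d`. -/
def betaFun (d : ℕ) (f : ℕ × ℕ → ℕ) : ℕ × ℕ → ℕ := fun b =>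
  if 1 ≤ b.1 ∧ b.1 ≤ d ∧ b.2 = rowLen f b.1 + 1 then tlen f + 1 else f b

/-- The number of boxes of row `x` of `f` whose label is at most `r` (these occupy an initial
segment of the row). -/
def lowLen (f : ℕ × ℕ → ℕ) (r x : ℕ) : ℕ := sSup {y | f (x, y) ≠ 0 ∧ f (x, y) ≤ r}

/-- The row index `d` used in the definition of `Ĉ(r)`: the minimal `k ∈ [n-1]` with
`C (k, n-k) ≤ r` if such `k` exists, and `n` otherwise. -/
def hatD (f : ℕ × ℕ → ℕ) (n r : ℕ) : ℕ :=
  sInf ({k | 1 ≤ k ∧ k ≤ n - 1 ∧ 1 ≤ f (k, n - k) ∧ f (k, n - k) ≤ r} ∪ {n})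

/-- `Ĉ(r)` for `C ∈ C_i(n)` and `0 ≤ r ≤ n + i`: starting from `β_d(α_d(C^(r)))` (where `d` is
as in `hatD`), the entries of `C` greater than `r` of row index less than `d` are translated one
unit to the right, those of row index greater than `d` are translated one unit down, and all
these labels are incremented by one. -/
def hatFun (f : ℕ × ℕ → ℕ) (n r : ℕ) : ℕ × ℕ → ℕ := fun b =>
  let d := hatD f n r
  let x := b.1
  let y := b.2
  if x = 0 ∨ y = 0 then 0
  else if x ≤ d then
    if f (x, y) ≠ 0 ∧ f (x, y) ≤ r then f (x, y)
    else if y = lowLen f r x + 1 then r + 1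
    else if r < f (x, y - 1) then f (x, y - 1) + 1
    else 0
  else if x = d + 1 then f (d, y)
  else if f (x - 1, y) = 0 then 0
  else if f (x - 1, y) ≤ r then f (x - 1, y)
  else f (x - 1, y) + 1

/-- `RepBy i m t r C0 C` : `C = (φ_{i,m+t-1}^{r 1} ∘ φ_{i,m+t-2}^{r 2} ∘ ⋯ ∘ φ_{i,m}^{r t}) C0`,
each factor being applied within its domain. -/
def RepBy (i : ℤ) (m t : ℕ) (r : ℕ → ℕ) (C0 C : ℕ × ℕ → ℕ) : Prop :=
  ∃ D : ℕ → ℕ × ℕ → ℕ, D 0 = C0 ∧ D t = C ∧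
    ∀ s, s < t →
      MemC i (m + s) (D s) ∧
      ((r (t - s) : ℤ) ≤ (m : ℤ) + s + i) ∧
      (∀ j, 1 ≤ j → j ≤ r (t - s) → ¬ HasPlusFullSet (D s) (m + s) j) ∧
      D (s + 1) = hatFun (D s) (m + s) (r (t - s))

/-- The set `𝕏_{d,n-1}^r` of Theorem 4.3: `ψ`-tableaux of length `r`, contained in `δ_{n-1}`,
whose row `d` has length `n - d` and whose prime path of row `d` has height `d`. -/
def MemX (d n r : ℕ) (f : ℕ × ℕ → ℕ) : Prop :=
  IsTableau f ∧ IsPsiTab f ∧ tlen f = r ∧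
    (∀ x, 1 ≤ x → rowLen f x ≤ n - x) ∧
    rowLen f d = n - d ∧
    primeHeight (shapeOf f) d = d

/-- The set `ℤ_{d,n}^{r+1}` of Theorem 4.3: `ψ`-tableaux of length `r + 1`, contained in `δ_n`,
such that rows `d` and `d+1` of the truncation at `r` are identical, the end-box of the
`(r+1)`-set is `(d, n-d+1)`, and the prime path of `(d, n-d+1)` has height `d`. -/
def MemZ (d n r : ℕ) (g : ℕ × ℕ → ℕ) : Prop :=
  IsTableau g ∧ IsPsiTab g ∧ tlen g = r + 1 ∧
    (∀ x, 1 ≤ x → rowLen g x ≤ n + 1 - x) ∧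
    (∀ y, trunc g r (d, y) = trunc g r (d + 1, y)) ∧
    g (d, n - d + 1) = r + 1 ∧ (∀ x y, g (x, y) = r + 1 → x ≤ d) ∧
    primeHeight (shapeOf g) d = d

/-- Number of north steps read before the level drops from `m` to `0`. -/
def ht : ℕ → List Step → ℕ
  | 0, _ => 0
  | _ + 1, [] => 0
  | m + 1, Step.N :: w => 1 + ht (m + 2) w
  | m + 1, Step.E :: w => ht m w

/-- Height of the prime subpath beginning at the north step of index `k` (from `0`). -/
def htAt : ℕ → List Step → ℕ
  | _, [] => 0
  | 0, Step.N :: w => 1 + ht 1 w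
  | k + 1, Step.N :: w => htAt k w
  | k, Step.E :: w => htAt k w

lemma nCount_nil : nCount [] = 0 := rfl
lemma eCount_nil : eCount [] = 0 := rfl
lemma nCount_N (w : List Step) : nCount (Step.N :: w) = nCount w + 1 := by simp [nCount]
lemma nCount_E (w : List Step) : nCount (Step.E :: w) = nCount w := by simp [nCount]
lemma eCount_N (w : List Step) : eCount (Step.N :: w) = eCount w := by simp [eCount]
lemma eCount_E (w : List Step) : eCount (Step.E :: w) = eCount w + 1 := by simp [eCount]
lemma nCount_app (v w : List Step) : nCount (v ++ w) = nCount v + nCount w := by simp [nCount]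
lemma eCount_app (v w : List Step) : eCount (v ++ w) = eCount v + eCount w := by simp [eCount]

/-- The height is the number of north steps of a path that first reaches `0` at its end. -/
lemma ht_first (q b : List Step) : ∀ m : ℕ,
    (∀ s, s <+: q → s ≠ q → eCount s < nCount s + m) → eCount q = nCount q + m →
    ht m (q ++ b) = nCount q := by
  induction q with
  | nil =>
    intro m _ h2
    rw [eCount_nil, nCount_nil] at h2
    obtain rfl : m = 0 := by omega
    simp [ht, nCount_nil]
  | cons x q ih =>
    intro m h1 h2
    have h0 := h1 [] (by simp) (by simp)
    rw [eCount_nil, nCount_nil] at h0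
    obtain ⟨m, rfl⟩ : ∃ m', m = m' + 1 := ⟨m - 1, by omega⟩
    cases x with
    | N =>
      rw [List.cons_append, ht, ih, nCount_N]
      · omega
      · intro s hs hne
        have := h1 (Step.N :: s) (by simpa using hs) (by simpa using hne)
        rw [eCount_N, nCount_N] at this
        omega
      · rw [eCount_N, nCount_N] at h2
        omega
    | E =>
      rw [List.cons_append, ht, ih, nCount_E]
      · intro s hs hne
        have := h1 (Step.E :: s) (by simpa using hs) (by simpa using hne)
        rw [eCount_E, nCount_E] at this
        omega
      · rw [eCount_E, nCount_E] at h2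
        omega

/-- A subpath that never reaches level `0` contributes all its north steps. -/
lemma ht_pass (q b : List Step) : ∀ m r : ℕ,
    (∀ s, s <+: q → eCount s < nCount s + m) → eCount q + r = nCount q + m →
    ht m (q ++ b) = nCount q + ht r b := by
  induction q with
  | nil =>
    intro m r _ h2
    rw [eCount_nil, nCount_nil] at h2
    obtain rfl : m = r := by omega
    simp [nCount_nil]
  | cons x q ih =>
    intro m r h1 h2
    have h0 := h1 [] (by simp)
    rw [eCount_nil, nCount_nil] at h0
    obtain ⟨m, rfl⟩ : ∃ m', m = m' + 1 := ⟨m - 1, by omega⟩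
    cases x with
    | N =>
      rw [List.cons_append, ht, ih (m + 2) r, nCount_N]
      · omega
      · intro s hs
        have := h1 (Step.N :: s) (by simpa using hs)
        rw [eCount_N, nCount_N] at this
        omega
      · rw [eCount_N, nCount_N] at h2
        omega
    | E =>
      rw [List.cons_append, ht, ih m r, nCount_E]
      · intro s hs
        have := h1 (Step.E :: s) (by simpa using hs)
        rw [eCount_E, nCount_E] at this
        omega
      · rw [eCount_E, nCount_E] at h2
        omega

/-- If level `0` is reached within `q`, what follows `q` does not matter. -/
lemma ht_congr (q w w' : List Step) : ∀ m : ℕ, m + nCount q ≤ eCount q →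
    ht m (q ++ w) = ht m (q ++ w') := by
  induction q with
  | nil =>
    intro m h
    rw [eCount_nil, nCount_nil] at h
    obtain rfl : m = 0 := by omega
    simp [ht]
  | cons x q ih =>
    intro m h
    cases m with
    | zero => simp [ht]
    | succ m =>
      cases x with
      | N =>
        rw [eCount_N, nCount_N] at h
        simp only [List.cons_append, ht]
        rw [ih (m + 2) (by omega)]
      | E =>
        rw [eCount_E, nCount_E] at h
        simp only [List.cons_append, ht]
        rw [ih m (by omega)]

lemma htAt_E (k : ℕ) (w : List Step) : htAt k (Step.E :: w) = htAt k w := by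
  cases k <;> simp [htAt]

lemma prime_pre_le {q : List Step} (hq : IsPrimeDyck q) (s : List Step) (hs : s <+: q) :
    eCount s ≤ nCount s := by
  by_cases h1 : s = []
  · subst h1; simp [eCount_nil]
  · by_cases h2 : s = q
    · subst h2; exact hq.2.1.symm.le
    · exact (hq.2.2 s hs h1 h2).le

/-- The height of a prime subpath is computed by `htAt`. -/
lemma htAt_prime (a q b : List Step) (hq : IsPrimeDyck q) :
    htAt (nCount a) (a ++ (q ++ b)) = nCount q := by
  induction a with
  | nil =>
    cases q with
    | nil => exact absurd rfl hq.1
    | cons x q =>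
      cases x with
      | E =>
        have := prime_pre_le hq [Step.E] (by simp)
        simp [eCount, nCount] at this
      | N =>
        have hbal := hq.2.1
        rw [nCount_N, eCount_N] at hbal
        simp only [nCount_nil, List.nil_append, List.cons_append, htAt]
        rw [ht_first q b 1, nCount_N, add_comm]
        · intro s hs hne
          have := hq.2.2 (Step.N :: s) (by simpa using hs) (by simp) (by simpa using hne)
          rwa [eCount_N, nCount_N] at this
        · exact hbal.symm
  | cons x a ih =>
    cases x with
    | N => rw [nCount_N, List.cons_append, htAt, ih]
    | E => rw [nCount_E, List.cons_append, htAt_E, ih]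

/-- Inserting an east step after a path all of whose suffixes descend does not change heights. -/
lemma htAt_insert (q b : List Step) : ∀ k : ℕ,
    (∀ s t, q = s ++ t → nCount t ≤ eCount t) →
    htAt k (q ++ Step.E :: b) = htAt k (q ++ b) := by
  induction q with
  | nil => intro k _; simp [htAt_E]
  | cons x q ih =>
    intro k h
    have h' : ∀ s t, q = s ++ t → nCount t ≤ eCount t :=
      fun s t e => h (x :: s) t (by simp [e])
    cases x with
    | E => simp only [List.cons_append, htAt_E]; exact ih k h'
    | N =>
      cases k with
      | succ k => simp only [List.cons_append, htAt]; exact ih k h'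
      | zero =>
        have h0 := h [] (Step.N :: q) rfl
        rw [nCount_N, eCount_N] at h0
        simp only [List.cons_append, htAt]
        rw [ht_congr q (Step.E :: b) b 1 (by omega)]

lemma ht_cover (a q b : List Step) (hq : IsPrimeDyck q) : ∀ m : ℕ,
    ht m (a ++ Step.E :: (q ++ b)) ≤ ht m (a ++ (q ++ Step.E :: b)) := by
  have pass : ∀ (m : ℕ) (w : List Step), ht (m + 1) (q ++ w) = nCount q + ht (m + 1) w := by
    intro m w
    apply ht_pass
    · intro s hs
      have := prime_pre_le hq s hs
      omega
    · have := hq.2.1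
      omega
  induction a with
  | nil =>
    intro m
    cases m with
    | zero => simp [ht]
    | succ m =>
      rw [List.nil_append, List.nil_append, pass, ht, ht]
      cases m with
      | zero => simp [ht]
      | succ m => rw [pass]
  | cons x a ih =>
    intro m
    cases m with
    | zero => simp [ht]
    | succ m =>
      cases x with
      | N => simp only [List.cons_append, ht]; have := ih (m + 2); omega
      | E => simp only [List.cons_append, ht]; exact ih m

lemma htAt_cover (a q b : List Step) (hq : IsPrimeDyck q) : ∀ k : ℕ,
    htAt k (a ++ Step.E :: (q ++ b)) ≤ htAt k (a ++ (q ++ Step.E :: b)) := by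
  induction a with
  | nil =>
    intro k
    rw [List.nil_append, List.nil_append, htAt_E, htAt_insert]
    intro s t e
    have h1 := prime_pre_le hq s ⟨t, e.symm⟩
    have h2 := hq.2.1
    rw [e, nCount_app, eCount_app] at h2
    omega
  | cons x a ih =>
    intro k
    cases x with
    | E => simp only [List.cons_append, htAt_E]; exact ih k
    | N =>
      cases k with
      | succ k => simp only [List.cons_append, htAt]; exact ih k
      | zero =>
        simp only [List.cons_append, htAt]
        have := ht_cover a q b hq 1
        omega

/-- **Proposition 3.7.**  Let `1̂ = P 0 ⋗ P 1 ⋗ ⋯ ⋗ P l` be a saturated chain in the Tamari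
lattice `T_n` in terms of Dyck paths of length `2n`, beginning at the maximum element `1̂`.
Fix `k ∈ [n]`, and for `0 ≤ j ≤ l` let `h j` be the height of the prime Dyck subpath of `P j`
beginning with its `k`-th north step.  Then `h 0 ≥ h 1 ≥ ⋯ ≥ h l`. -/
theorem prime_heights_decrease (n l k : ℕ) (hk1 : 1 ≤ k) (hkn : k ≤ n)
    (P : ℕ → List Step) (h : ℕ → ℕ)
    (hP0 : P 0 = List.replicate n Step.N ++ List.replicate n Step.E)
    (hdyck : ∀ j, j ≤ l → IsDyck (P j) ∧ nCount (P j) = n)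
    (hcov : ∀ j, j < l → TamariCoverD (P j) (P (j + 1)))
    (hh : ∀ j, j ≤ l → ∃ a q b : List Step,
      P j = a ++ q ++ b ∧ nCount a = k - 1 ∧ IsPrimeDyck q ∧ h j = nCount q) :
    ∀ j, j < l → h (j + 1) ≤ h j := by
  intro j hj
  have key : ∀ i, i ≤ l → h i = htAt (k - 1) (P i) := by
    intro i hi
    obtain ⟨a, q, b, hP, ha, hq, hhi⟩ := hh i hi
    rw [hP, ← ha, List.append_assoc, htAt_prime a q b hq, hhi]
  rw [key j hj.le, key (j + 1) hj]
  obtain ⟨a, q, b, hq, h1, h2⟩ := hcov j hj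
  rw [h1, h2]
  exact htAt_cover a q b hq (k - 1)

end TamariMaxChains
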